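/- If τ_h ξ < 1 − |C|^{−1/2}, where |C| is the cardinality of C, then for every u ∈ E^B the sharper bound ‖P_h u − Π_h^C (P_h u)‖ ≤ (τ / (1 − τ_h ξ)) M holds; in other words, the optimal constant β in the inequality ‖P_h u − Π_h^C (P_h u)‖ ≤ β M (for all u ∈ E^B) satisfies β ≤ τ / (1 − τ_h ξ). -/

import Mathlib

open scoped RealInnerProductSpace

theorem Orthonormal.sum_inner_smul_of_mem_span {H κ : Type*} [NormedAddCommGroup H]
    [InnerProductSpace ℝ H] [Fintype κ] {e : κ → H} (he : Orthonormal ℝ e) {x : H}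
    (hx : x ∈ Submodule.span ℝ (Set.range e)) : ∑ i, ⟪e i, x⟫ • e i = x := by
  obtain ⟨c, rfl⟩ := (Submodule.mem_span_range_iff_exists_fun ℝ).1 hx
  exact Finset.sum_congr rfl fun i _ => by rw [he.inner_right_fintype]

/-- Bessel's inequality with bounded multipliers. -/
theorem Orthonormal.norm_sum_mul_inner_smul_le {H κ : Type*} [NormedAddCommGroup H]
    [InnerProductSpace ℝ H] {e : κ → H} (he : Orthonormal ℝ e) (s : Finset κ) (c : κ → ℝ)
    {t : ℝ} (ht : 0 ≤ t) (hc : ∀ i ∈ s, |c i| ≤ t) (x : H) :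
    ‖∑ i ∈ s, (c i * ⟪e i, x⟫) • e i‖ ≤ t * ‖x‖ := by
  refine le_of_sq_le_sq ?_ (by positivity)
  rw [← real_inner_self_eq_norm_sq, he.inner_sum, mul_pow]
  calc ∑ i ∈ s, (starRingEnd ℝ) (c i * ⟪e i, x⟫) * (c i * ⟪e i, x⟫)
      ≤ ∑ i ∈ s, t ^ 2 * ‖⟪e i, x⟫‖ ^ 2 := by
        refine Finset.sum_le_sum fun i hi => ?_
        have h : c i ^ 2 ≤ t ^ 2 := sq_le_sq' (abs_le.1 (hc i hi)).1 (abs_le.1 (hc i hi)).2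
        have := mul_le_mul_of_nonneg_right h (sq_nonneg ⟪e i, x⟫)
        simp only [Real.norm_eq_abs, sq_abs, conj_trivial]
        linarith
    _ ≤ t ^ 2 * ‖x‖ ^ 2 := by
        rw [← Finset.mul_sum]
        exact mul_le_mul_of_nonneg_left (he.sum_inner_products_le x) (sq_nonneg t)

/-- if τ_h ξ < 1 − |C|^{−1/2}, then for every u ∈ E^B,
‖P_h u − Π_h^C (P_h u)‖ ≤ (τ / (1 − τ_h ξ)) M; i.e. the optimal β satisfies
β ≤ τ / (1 − τ_h ξ). -/
theorem stmt4
    {H : Type*} [NormedAddCommGroup H] [InnerProductSpace ℝ H]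
    {ι : Type*} [Fintype ι] [DecidableEq ι]
    (V : Submodule ℝ H)
    (a : H →ₗ[ℝ] H →ₗ[ℝ] ℝ)
    (hsym : ∀ x ∈ V, ∀ y ∈ V, a x y = a y x)
    (C : Finset ι) (hC : C.Nonempty) (hCc : Cᶜ.Nonempty)
    (uh : ι → H) (huh : Orthonormal ℝ uh)
    (hVh : Submodule.span ℝ (Set.range uh) ≤ V)
    (lamh : ι → ℝ) (hlamh_pos : ∀ i, 0 < lamh i)
    (heigh : ∀ i : ι, ∀ vh ∈ Submodule.span ℝ (Set.range uh),
      a (uh i) vh = lamh i * ⟪uh i, vh⟫)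
    (u : ι → H) (hu : Orthonormal ℝ (fun (j : C) => u (j : ι)))
    (huV : ∀ j ∈ C, u j ∈ V)
    (lam : ι → ℝ) (hlam_pos : ∀ j ∈ C, 0 < lam j)
    (heig : ∀ j ∈ C, ∀ v ∈ V, a (u j) v = lam j * ⟪u j, v⟫)
    (hsep : ∀ i ∈ Cᶜ, ∀ j ∈ C, lamh i ≠ lam j)
    (Ph : H →ₗ[ℝ] H)
    (hPh_mem : ∀ w : H, Ph w ∈ Submodule.span ℝ (Set.range uh))
    (hGal : ∀ w ∈ V, ∀ vh ∈ Submodule.span ℝ (Set.range uh), a (w - Ph w) vh = 0)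
    (Pic : H →ₗ[ℝ] H)
    (hPic_mem : ∀ φ : H, Pic φ ∈ Submodule.span ℝ (uh '' (C : Set ι)))
    (hPic_orth : ∀ φ : H, ∀ w ∈ Submodule.span ℝ (uh '' (C : Set ι)), ⟪φ - Pic φ, w⟫ = 0)
    (τ τh : ℝ)
    (hτ : τ = C.sup' hC fun j => Cᶜ.sup' hCc fun i => lam j / |lamh i - lam j|)
    (hτh : τh = C.sup' hC fun j => Cᶜ.sup' hCc fun i => lamh i / |lamh i - lam j|)
    (M : ℝ)
    (hM : M = sSup ((fun v => ‖v - Ph v‖) ''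
      {v : H | v ∈ Submodule.span ℝ (u '' (C : Set ι)) ∧ ‖v‖ = 1}))
    (lamn lamN ξ : ℝ)
    (hlamn : lamn = C.inf' hC lam) (hlamN : lamN = C.sup' hC lam)
    (hξ : ξ = (lamN - lamn) / lamn)
    (hcond : τh * ξ < 1 - (Real.sqrt C.card)⁻¹) :
    ∀ w ∈ Submodule.span ℝ (u '' (C : Set ι)), ‖w‖ = 1 →
      ‖Ph w - Pic (Ph w)‖ ≤ τ / (1 - τh * ξ) * M := by
  obtain ⟨n, hnC, hn⟩ := Finset.exists_mem_eq_inf' hC lam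
  rw [hn] at hlamn
  have hlamn_pos : 0 < lamn := hlamn ▸ hlam_pos n hnC
  have hle : ∀ j ∈ C, lamn ≤ lam j := fun j hj => by
    rw [hlamn, ← hn]; exact Finset.inf'_le _ hj
  have hge : ∀ j ∈ C, lam j ≤ lamN := fun j hj => by
    rw [hlamN]; exact Finset.le_sup' _ hj
  have hτ_le : ∀ i ∈ Cᶜ, lamn / |lamh i - lamn| ≤ τ := fun i hi => by
    rw [hτ, hlamn]
    exact (Finset.le_sup' (fun i => lam n / |lamh i - lam n|) hi).trans
      (Finset.le_sup' (fun j => Cᶜ.sup' hCc fun i => lam j / |lamh i - lam j|) hnC)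
  have hτh_le : ∀ i ∈ Cᶜ, lamh i / |lamh i - lamn| ≤ τh := fun i hi => by
    rw [hτh, hlamn]
    exact (Finset.le_sup' (fun i => lamh i / |lamh i - lam n|) hi).trans
      (Finset.le_sup' (fun j => Cᶜ.sup' hCc fun i => lamh i / |lamh i - lam j|) hnC)
  obtain ⟨i₀, hi₀⟩ := hCc
  have hτ0 : 0 ≤ τ := (by positivity : 0 ≤ lamn / |lamh i₀ - lamn|).trans (hτ_le i₀ hi₀)
  have hτh0 : 0 ≤ τh := (div_nonneg (hlamh_pos i₀).le (abs_nonneg _)).trans (hτh_le i₀ hi₀)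
  have hξ0 : 0 ≤ ξ := by
    rw [hξ]
    exact div_nonneg (sub_nonneg.2 ((hle n hnC).trans (hge n hnC))) hlamn_pos.le
  have hq : 0 < 1 - τh * ξ := by
    have : 0 ≤ (Real.sqrt C.card)⁻¹ := by positivity
    linarith
  have huh_mem : ∀ i, uh i ∈ Submodule.span ℝ (Set.range uh) :=
    fun i => Submodule.subset_span ⟨i, rfl⟩
  have hrange : u '' (C : Set ι) = Set.range fun j : C => u j := by
    rw [Set.image_eq_range]; rfl
  set E : Submodule ℝ H := Submodule.span ℝ (u '' (C : Set ι)) with hE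
  have : FiniteDimensional ℝ E :=
    FiniteDimensional.span_of_finite ℝ (C.finite_toSet.image u)
  have hM_le : ∀ w ∈ E, ‖w‖ = 1 → ‖w - Ph w‖ ≤ M := by
    intro w hw hw1
    let R : E →L[ℝ] H := LinearMap.toContinuousLinearMap ((LinearMap.id - Ph).domRestrict E)
    rw [hM]
    refine le_csSup ⟨‖R‖, ?_⟩ ⟨w, ⟨hw, hw1⟩, rfl⟩
    rintro _ ⟨v, ⟨hv, hv1⟩, rfl⟩
    have h := R.le_opNorm ⟨v, hv⟩
    rw [Submodule.coe_norm, hv1, mul_one] at h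
    exact h
  have hM0 : 0 ≤ M := by
    rw [hM]
    refine Real.sSup_nonneg ?_
    rintro _ ⟨v, -, rfl⟩
    exact norm_nonneg _
  have hGal_eig : ∀ i, ∀ j ∈ C, lamh i * ⟪uh i, Ph (u j)⟫ = lam j * ⟪uh i, u j⟫ := by
    intro i j hj
    have h1 := hGal (u j) (huV j hj) (uh i) (huh_mem i)
    rw [map_sub, LinearMap.sub_apply, heig j hj _ (hVh (huh_mem i)),
      hsym _ (hVh (hPh_mem _)) _ (hVh (huh_mem i)), heigh i _ (hPh_mem _),
      real_inner_comm] at h1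
    linarith
  let S : E →L[ℝ] H := LinearMap.toContinuousLinearMap ((Ph - Pic ∘ₗ Ph).domRestrict E)
  have hS : ∀ (v : H) (hv : v ∈ E), S ⟨v, hv⟩ = Ph v - Pic (Ph v) := fun _ _ => rfl
  have hcoefC : ∀ v, ∀ i ∈ C, ⟪uh i, Ph v - Pic (Ph v)⟫ = 0 := fun v i hi => by
    rw [real_inner_comm]
    exact hPic_orth _ _ (Submodule.subset_span ⟨i, hi, rfl⟩)
  have hcoef : ∀ v, ∀ i ∈ Cᶜ, ⟪uh i, Ph v - Pic (Ph v)⟫ = ⟪uh i, Ph v⟫ := fun v i hi => by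
    have h : ⟪uh i, Pic (Ph v)⟫ = 0 := by
      refine Submodule.span_induction (p := fun x _ => ⟪uh i, x⟫ = 0) ?_ (inner_zero_right _)
        (fun x y _ _ hx hy => by rw [inner_add_right, hx, hy, add_zero])
        (fun r x _ hx => by rw [real_inner_smul_right, hx, mul_zero]) (hPic_mem (Ph v))
      rintro _ ⟨k, hk, rfl⟩
      exact huh.2 fun h => Finset.mem_compl.1 hi (h ▸ hk)
    rw [inner_sub_right, h, sub_zero]
  have hexp : ∀ v, Ph v - Pic (Ph v) = ∑ i ∈ Cᶜ, ⟪uh i, Ph v - Pic (Ph v)⟫ • uh i := fun v => by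
    have hmem : Ph v - Pic (Ph v) ∈ Submodule.span ℝ (Set.range uh) :=
      Submodule.sub_mem _ (hPh_mem v)
        (Submodule.span_mono (Set.image_subset_range _ _) (hPic_mem _))
    conv_lhs => rw [← huh.sum_inner_smul_of_mem_span hmem]
    rw [← Finset.sum_compl_add_sum C, Finset.sum_eq_zero (s := C), add_zero]
    intro i hi
    rw [hcoefC v i hi, zero_smul]
  have hSbound : ‖S‖ ≤ τ * M + τh * ξ * ‖S‖ := by
    refine ContinuousLinearMap.opNorm_le_of_unit_norm (by positivity) ?_
    rintro ⟨w, hw⟩ hw1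
    rw [Submodule.coe_norm] at hw1
    change ‖w‖ = 1 at hw1
    let N : H := ∑ j : C, ((1 - lamn / lam j) * ⟪u j, w⟫) • u j
    have hNE : N ∈ E := Submodule.sum_mem _ fun j _ => Submodule.smul_mem _ _
      (Submodule.subset_span ⟨j, j.2, rfl⟩)
    have hN : ‖N‖ ≤ ξ := by
      have h := hu.norm_sum_mul_inner_smul_le Finset.univ (fun j : C => 1 - lamn / lam j) hξ0
        (fun j _ => ?_) w
      · rwa [hw1, mul_one] at h
      · have hj := hlam_pos j j.2
        have h1 := hle j j.2
        have h2 := hge j j.2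
        have hsub : 1 - lamn / lam j = (lam j - lamn) / lam j := by field_simp
        rw [hsub, abs_of_nonneg (div_nonneg (sub_nonneg.2 h1) hj.le), hξ]
        exact div_le_div₀ (by linarith) (by linarith) hlamn_pos h1
    have hwN : w - N = ∑ j : C, (lamn / lam j * ⟪u j, w⟫) • u j := by
      rw [hE, hrange] at hw
      conv_lhs => rw [← hu.sum_inner_smul_of_mem_span hw]
      rw [← Finset.sum_sub_distrib]
      refine Finset.sum_congr rfl fun j _ => ?_
      rw [← sub_smul]
      congr 1
      ring
    have hres : ∀ i, lamh i * ⟪uh i, Ph (w - N)⟫ = lamn * ⟪uh i, w⟫ := by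
      intro i
      have hw' := hw
      rw [hE, hrange] at hw'
      conv_rhs => rw [← hu.sum_inner_smul_of_mem_span hw']
      rw [hwN, map_sum, inner_sum, inner_sum, Finset.mul_sum, Finset.mul_sum]
      refine Finset.sum_congr rfl fun j _ => ?_
      rw [map_smul, real_inner_smul_right, real_inner_smul_right, mul_left_comm,
        hGal_eig i j j.2]
      have hj := (hlam_pos j j.2).ne'
      field_simp
    have hsplit : S ⟨w, hw⟩ =
        ∑ i ∈ Cᶜ, (lamn / (lamh i - lamn) * ⟪uh i, w - Ph w⟫) • uh i +
        ∑ i ∈ Cᶜ, (lamh i / (lamh i - lamn) * ⟪uh i, S ⟨N, hNE⟩⟫) • uh i := by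
      rw [hS w hw, hexp w, ← Finset.sum_add_distrib]
      refine Finset.sum_congr rfl fun i hi => ?_
      rw [← add_smul, hS N hNE, hcoef w i hi, hcoef N i hi]
      congr 1
      have hne : lamh i - lamn ≠ 0 := sub_ne_zero.2 (hlamn ▸ hsep i hi n hnC)
      have h := hres i
      rw [map_sub, inner_sub_right] at h
      rw [inner_sub_right]
      field_simp
      linarith
    rw [hsplit]
    refine (norm_add_le _ _).trans (add_le_add ?_ ?_)
    · refine (huh.norm_sum_mul_inner_smul_le Cᶜ _ hτ0 (fun i hi => ?_) _).trans
        (mul_le_mul_of_nonneg_left (hM_le w hw hw1) hτ0)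
      rw [abs_div, abs_of_pos hlamn_pos]
      exact hτ_le i hi
    · refine (huh.norm_sum_mul_inner_smul_le Cᶜ _ hτh0 (fun i hi => ?_) _).trans ?_
      · rw [abs_div, abs_of_pos (hlamh_pos i)]
        exact hτh_le i hi
      · rw [mul_assoc]
        refine mul_le_mul_of_nonneg_left ?_ hτh0
        rw [mul_comm ξ]
        exact (S.le_opNorm _).trans (mul_le_mul_of_nonneg_left hN (norm_nonneg _))
  intro w hw hw1
  have h := S.le_opNorm ⟨w, hw⟩
  rw [Submodule.coe_norm, hw1, mul_one, hS w hw] at h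
  refine h.trans ?_
  rw [div_mul_eq_mul_div, le_div_iff₀ hq]
  linarith
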